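/- The ℤ²-graded algebra C_{6,2} has no bigraded system of parameters: there do not exist 37 bihomogeneous elements P₁, …, P₃₇ of C_{6,2} (37 being the Krull dimension of C_{6,2}) such that C_{6,2} is a finitely generated module over the subalgebra K[P₁, …, P₃₇] they generate. -/

import Mathlib

open MvPolynomial Matrix

noncomputable section

/-- Index type for the entries of a pair of generic `n × n` matrices:
`Sum.inl (i,j)` indexes the `(i,j)` entry of `x`, `Sum.inr (i,j)` that of `y`. -/
abbrev MatVar (n : ℕ) := (Fin n × Fin n) ⊕ (Fin n × Fin n)

/-- The substitution sending the variables to the entries of the pair `(A, B)`. -/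
def pairSub {K : Type*} [CommSemiring K] {n : ℕ} (A B : Matrix (Fin n) (Fin n) K) :
    MatVar n → K
  | Sum.inl ij => A ij.1 ij.2
  | Sum.inr ij => B ij.1 ij.2

/-- A polynomial function on pairs of `n × n` matrices is `GLₙ`-invariant (for the action
by simultaneous conjugation). -/
def IsMatInvariant {K : Type*} [Field K] {n : ℕ} (f : MvPolynomial (MatVar n) K) : Prop :=
  ∀ (a : GL (Fin n) K) (A B : Matrix (Fin n) (Fin n) K),
    MvPolynomial.eval
        (pairSub ((a : Matrix (Fin n) (Fin n) K) * A * ((a⁻¹ : GL (Fin n) K) : Matrix (Fin n) (Fin n) K))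
          ((a : Matrix (Fin n) (Fin n) K) * B * ((a⁻¹ : GL (Fin n) K) : Matrix (Fin n) (Fin n) K))) f =
      MvPolynomial.eval (pairSub A B) f

/-- The weight giving the bidegree: entries of `x` have weight `(1,0)`,
those of `y` have weight `(0,1)`. -/
def bideg (n : ℕ) : MatVar n → ℕ × ℕ
  | Sum.inl _ => (1, 0)
  | Sum.inr _ => (0, 1)

/-- The bigraded component of bidegree `(p, q)` of the pure trace algebra `C_{n,2}`. -/
def pureComponent (K : Type*) [Field K] (n p q : ℕ) : Set (MvPolynomial (MatVar n) K) :=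
  {f | IsMatInvariant f ∧ f.IsWeightedHomogeneous (bideg n) (p, q)}

/-- `dim_K C_{n,2}^{(p,q)}`. -/
def pureDim (K : Type*) [Field K] (n p q : ℕ) : ℕ :=
  Set.finrank K (pureComponent K n p q)

/-- The bigraded Poincaré series `P(C_{n,2}; s, t)`, with `s` the variable `X 0` and
`t` the variable `X 1`. -/
def purePS2 (K : Type*) [Field K] (n : ℕ) : MvPowerSeries (Fin 2) ℚ :=
  fun d => (pureDim K n (d 0) (d 1) : ℚ)

/-- abbreviation for the power series variable `s`. -/
def ps : MvPowerSeries (Fin 2) ℚ := MvPowerSeries.X 0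

/-- abbreviation for the power series variable `t`. -/
def pt : MvPowerSeries (Fin 2) ℚ := MvPowerSeries.X 1


/-- The pure trace algebra `C_{n,2}`: the subalgebra of `GLₙ`-invariant polynomial
functions on pairs of `n × n` matrices. -/
def pureAlg (K : Type*) [Field K] (n : ℕ) : Subalgebra K (MvPolynomial (MatVar n) K) where
  carrier := {f | IsMatInvariant f}
  mul_mem' := fun hf hg a A B => by
    simp only [_root_.map_mul]
    rw [hf a A B, hg a A B]
  add_mem' := fun hf hg a A B => by
    simp only [_root_.map_add]
    rw [hf a A B, hg a A B]
  algebraMap_mem' := fun c a A B => by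
    simp [MvPolynomial.algebraMap_eq]


/-- Evaluation of a word (a list of letters) on a pair of matrices. -/
def wordEv {R : Type*} [CommRing R] (l : List Bool) (A B : Matrix (Fin 6) (Fin 6) R) :
    Matrix (Fin 6) (Fin 6) R :=
  (l.map (fun t => if t then A else B)).prod

lemma wordEv_map {R S : Type*} [CommRing R] [CommRing S] (f : R →+* S) (l : List Bool)
    (A B : Matrix (Fin 6) (Fin 6) R) :
    (wordEv l A B).map f = wordEv l (A.map f) (B.map f) := by
  unfold wordEv
  induction l with
  | nil => simp [Matrix.map_one]
  | cons t l ih =>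
    rw [List.map_cons, List.prod_cons, Matrix.map_mul, ih, List.map_cons, List.prod_cons]
    cases t <;> simp

lemma wordEv_conj {R : Type*} [CommRing R] (l : List Bool) (a : GL (Fin 6) R)
    (A B : Matrix (Fin 6) (Fin 6) R) :
    wordEv l (a.val * A * a⁻¹.val) (a.val * B * a⁻¹.val) = a.val * wordEv l A B * a⁻¹.val := by
  have h : a⁻¹.val * a.val = 1 := by rw [← Units.val_mul]; simp
  have h' : a.val * a⁻¹.val = 1 := by rw [← Units.val_mul]; simp
  unfold wordEv
  induction l with
  | nil => simp only [List.map_nil, List.prod_nil, mul_one]; exact h'.symm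
  | cons t l ih =>
    rw [List.map_cons, List.prod_cons, ih, List.map_cons, List.prod_cons]
    have : ∀ M N : Matrix (Fin 6) (Fin 6) R,
        (a.val * M * a⁻¹.val) * (a.val * N * a⁻¹.val) = a.val * (M * N) * a⁻¹.val := by
      intro M N
      calc _ = a.val * M * (a⁻¹.val * a.val) * N * a⁻¹.val := by simp only [mul_assoc]
        _ = _ := by rw [h]; simp only [mul_assoc, mul_one]
    cases t <;> simp only [this, if_true, if_false, Bool.false_eq_true]

/-- generic matrices -/
def genX (K : Type*) [Field K] : Matrix (Fin 6) (Fin 6) (MvPolynomial (MatVar 6) K) :=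
  Matrix.of fun i j => MvPolynomial.X (Sum.inl (i, j))

/-- generic matrices -/
def genY (K : Type*) [Field K] : Matrix (Fin 6) (Fin 6) (MvPolynomial (MatVar 6) K) :=
  Matrix.of fun i j => MvPolynomial.X (Sum.inr (i, j))

lemma genX_map {K R : Type*} [Field K] [CommRing R] [Algebra K R]
    (A B : Matrix (Fin 6) (Fin 6) R) :
    (genX K).map (aeval (R := K) (pairSub A B)).toRingHom = A := by
  ext i j; simp [genX, pairSub]

lemma genY_map {K R : Type*} [Field K] [CommRing R] [Algebra K R]
    (A B : Matrix (Fin 6) (Fin 6) R) :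
    (genY K).map (aeval (R := K) (pairSub A B)).toRingHom = B := by
  ext i j; simp [genY, pairSub]

lemma aeval_coeff {K R : Type*} [Field K] [CommRing R] [Algebra K R]
    (A B : Matrix (Fin 6) (Fin 6) R) (l : List Bool) (k : ℕ) :
    aeval (R := K) (pairSub A B) ((wordEv l (genX K) (genY K)).charpoly.coeff k) =
      (wordEv l A B).charpoly.coeff k := by
  have := Matrix.charpoly_map (wordEv l (genX K) (genY K)) (aeval (R := K) (pairSub A B)).toRingHom
  rw [wordEv_map, genX_map, genY_map] at this
  rw [this, Polynomial.coeff_map]; rfl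

lemma charpoly_conj_coeff {R : Type*} [CommRing R] (a : GL (Fin 6) R)
    (A : Matrix (Fin 6) (Fin 6) R) (k : ℕ) :
    (a.val * A * a⁻¹.val).charpoly.coeff k = A.charpoly.coeff k := by
  have h : a⁻¹.val = a.val⁻¹ := Matrix.coe_units_inv a
  rw [h, Matrix.charpoly_units_conj]

lemma eval_coeff {K : Type*} [Field K]
    (A B : Matrix (Fin 6) (Fin 6) K) (l : List Bool) (k : ℕ) :
    eval (pairSub A B) ((wordEv l (genX K) (genY K)).charpoly.coeff k) =
      (wordEv l A B).charpoly.coeff k := by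
  have := aeval_coeff (K := K) A B l k
  rwa [aeval_eq_eval] at this

lemma coeff_mem' {K : Type*} [Field K] (l : List Bool) (k : ℕ) :
    IsMatInvariant ((wordEv l (genX K) (genY K)).charpoly.coeff k) := by
  generalize hg : (wordEv l (genX K) (genY K)).charpoly.coeff k = g
  intro a A B
  rw [← hg, eval_coeff, eval_coeff, wordEv_conj, charpoly_conj_coeff]

lemma coeff_mem {K : Type*} [Field K] (l : List Bool) (k : ℕ) :
    (wordEv l (genX K) (genY K)).charpoly.coeff k ∈ pureAlg K 6 := by
  have := coeff_mem' (K := K) l k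
  generalize (wordEv l (genX K) (genY K)).charpoly.coeff k = g at *
  exact this

lemma integral_of_root {A R : Type*} [CommRing A] [CommRing R] [Algebra A R]
    (f : Polynomial R) (hf : f.Monic) (hco : ∀ n, IsIntegral A (f.coeff n)) (x : R)
    (hx : f.eval x = 0) : IsIntegral A x := by
  have hB : IsIntegral (integralClosure A R) x := by
    have hl : f ∈ Polynomial.lifts (algebraMap (integralClosure A R) R) := by
      rw [Polynomial.lifts_iff_coeff_lifts]
      intro n
      exact ⟨⟨_, hco n⟩, rfl⟩
    obtain ⟨g, hg, -, hgm⟩ := Polynomial.lifts_and_natDegree_eq_and_monic hl hf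
    refine ⟨g, hgm, ?_⟩
    rw [← Polynomial.eval_map, hg, hx]
  exact isIntegral_trans _ hB

lemma scale_eval {K : Type*} [Field K] {f : MvPolynomial (MatVar 6) K} {p q : ℕ}
    (hf : f.IsWeightedHomogeneous (bideg 6) (p, q)) (s t : K) (A B : Matrix (Fin 6) (Fin 6) K) :
    eval (pairSub (s • A) (t • B)) f = s ^ p * t ^ q * eval (pairSub A B) f := by
  rw [eval_eq', eval_eq', Finset.mul_sum]
  refine Finset.sum_congr rfl fun d hd => ?_
  have hw := hf (mem_support_iff.mp hd)
  have h1 : ∑ i, d (Sum.inl i) = p := by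
    have := congrArg Prod.fst hw
    simpa [Finsupp.weight_apply, Finsupp.sum_fintype, bideg, Prod.fst_sum] using this
  have h2 : ∑ i, d (Sum.inr i) = q := by
    have := congrArg Prod.snd hw
    simpa [Finsupp.weight_apply, Finsupp.sum_fintype, bideg, Prod.snd_sum] using this
  simp only [Fintype.prod_sum_type, pairSub, Matrix.smul_apply, smul_eq_mul, mul_pow,
    Finset.prod_mul_distrib, Finset.prod_pow_eq_pow_sum, h1, h2]
  ring

lemma eval_zero {K : Type*} [Field K] [CharZero K] {f : MvPolynomial (MatVar 6) K} {p q : ℕ}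
    (hi : f ∈ pureAlg K 6)
    (hf : f.IsWeightedHomogeneous (bideg 6) (p, q)) (a b : ℕ) (hab : a * p ≠ b * q)
    (A B : Matrix (Fin 6) (Fin 6) K)
    (hA : ∀ i j, A i j ≠ 0 → (i : ℕ) = j + a) (hB : ∀ i j, B i j ≠ 0 → (i : ℕ) + b = j) :
    eval (pairSub A B) f = 0 := by
  have h2 : (2 : K) ≠ 0 := two_ne_zero
  let D : GL (Fin 6) K :=
    ⟨Matrix.diagonal fun i => 2 ^ (i : ℕ), Matrix.diagonal fun i => (2 ^ (i : ℕ))⁻¹,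
      by simp [Matrix.diagonal_mul_diagonal], by simp [Matrix.diagonal_mul_diagonal]⟩
  have hDA : D.val * A * D⁻¹.val = (2 ^ a : K) • A := by
    ext i j
    change (Matrix.diagonal (fun i : Fin 6 => (2 : K) ^ (i : ℕ)) * A *
      Matrix.diagonal (fun i : Fin 6 => ((2 : K) ^ (i : ℕ))⁻¹)) i j = _
    rw [Matrix.mul_diagonal, Matrix.diagonal_mul, Matrix.smul_apply, smul_eq_mul]
    by_cases h : A i j = 0
    · simp [h]
    · rw [hA i j h, pow_add]; field_simp
  have hDB : D.val * B * D⁻¹.val = ((2 ^ b)⁻¹ : K) • B := by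
    ext i j
    change (Matrix.diagonal (fun i : Fin 6 => (2 : K) ^ (i : ℕ)) * B *
      Matrix.diagonal (fun i : Fin 6 => ((2 : K) ^ (i : ℕ))⁻¹)) i j = _
    rw [Matrix.mul_diagonal, Matrix.diagonal_mul, Matrix.smul_apply, smul_eq_mul]
    by_cases h : B i j = 0
    · simp [h]
    · rw [← hB i j h, pow_add]; field_simp
  have := hi D A B
  rw [hDA, hDB, scale_eval hf] at this
  by_contra hne
  have h3 : ((2 ^ a) ^ p * ((2 ^ b)⁻¹) ^ q : K) = 1 := by
    apply mul_right_cancel₀ hne; rw [this, one_mul]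
  rw [inv_pow, mul_inv_eq_one₀ (by positivity), ← pow_mul, ← pow_mul] at h3
  have h4 : (2 : ℕ) ^ (a * p) = 2 ^ (b * q) := by exact_mod_cast h3
  exact hab (Nat.pow_right_injective le_rfl h4)

lemma key {K : Type*} [Field K] [CharZero K] {P : Fin 37 → MvPolynomial (MatVar 6) K}
    {p q : Fin 37 → ℕ}
    (hP : ∀ i, P i ∈ pureAlg K 6)
    (hh : ∀ i, (P i).IsWeightedHomogeneous (bideg 6) (p i, q i))
    {m : ℕ} {Q : Fin m → MvPolynomial (MatVar 6) K}
    (hfin : ∀ f ∈ pureAlg K 6, ∃ c : Fin m → MvPolynomial (MatVar 6) K,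
            (∀ j, c j ∈ Algebra.adjoin K (Set.range P)) ∧ f = ∑ j, c j * Q j)
    (hQ : ∀ j, Q j ∈ pureAlg K 6)
    (a b r : ℕ) (X Y : Matrix (Fin 6) (Fin 6) (MvPolynomial (Fin r) K))
    (hX : ∀ i j, X i j ≠ 0 → (i : ℕ) = j + a) (hY : ∀ i j, Y i j ≠ 0 → (i : ℕ) + b = j)
    (l : List Bool)
    (hl : ∀ k, ∃ u : Fin 6 → MvPolynomial (Fin r) K, u ≠ 0 ∧
      wordEv l X Y *ᵥ u = (MvPolynomial.X k : MvPolynomial (Fin r) K) • u) :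
    r ≤ (Finset.univ.filter fun i => a * p i = b * q i ∧ (p i ≠ 0 ∨ q i ≠ 0)).card := by
  classical
  set S := Finset.univ.filter fun i => a * p i = b * q i ∧ (p i ≠ 0 ∨ q i ≠ 0) with hS
  let φ : MvPolynomial (MatVar 6) K →ₐ[K] MvPolynomial (Fin r) K := aeval (pairSub X Y)
  have hev : ∀ (s : Fin r → K) (f : MvPolynomial (MatVar 6) K),
      eval s (φ f) = eval (pairSub (X.map (eval s)) (Y.map (eval s))) f := by
    intro s f
    have : (aeval (R := K) s).comp φ =
        aeval (R := K) (pairSub (X.map (eval s)) (Y.map (eval s))) := by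
      ext v; rcases v with v | v <;> simp [φ, pairSub, aeval_eq_eval]
    have := congrArg (fun g => g f) this
    simpa [aeval_eq_eval] using this
  have hconst : ∀ i, i ∉ S → ∃ c : K, φ (P i) = C c := by
    intro i hi
    by_cases h : a * p i = b * q i
    · have h0 : p i = 0 ∧ q i = 0 := by
        simp only [hS, Finset.mem_filter, Finset.mem_univ, true_and] at hi
        grind
      refine ⟨eval (pairSub 0 0) (P i), MvPolynomial.funext fun s => ?_⟩
      have := scale_eval (hh i) 0 0 (X.map (eval s)) (Y.map (eval s))
      rw [hev, eval_C]
      simpa [h0.1, h0.2] using this.symm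
    · refine ⟨0, MvPolynomial.funext fun s => ?_⟩
      rw [hev, C_0, map_zero]
      refine eval_zero (hP i) (hh i) a b h _ _ (fun i j hij => hX i j ?_) (fun i j hij => hY i j ?_)
      · rintro h; simp [h] at hij
      · rintro h; simp [h] at hij
  let T : Set (MvPolynomial (Fin r) K) := (fun i => φ (P i)) '' (S : Set (Fin 37))
  let A := Algebra.adjoin K T
  have hsub : ∀ c ∈ Algebra.adjoin K (Set.range P), φ c ∈ A := by
    intro c hc
    have : Algebra.adjoin K (Set.range P) ≤ A.comap φ := by
      refine Algebra.adjoin_le ?_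
      rintro _ ⟨i, rfl⟩
      change φ (P i) ∈ A
      by_cases hi : i ∈ S
      · exact Algebra.subset_adjoin ⟨i, hi, rfl⟩
      · obtain ⟨c, hc⟩ := hconst i hi
        rw [hc]; exact A.algebraMap_mem c
    exact this hc
  -- images of invariants are integral over A
  have hint : ∀ f ∈ pureAlg K 6, IsIntegral A (φ f) := by
    intro f hf
    let N : Submodule A (MvPolynomial (Fin r) K) := Submodule.span A (Set.range fun j => φ (Q j))
    have hmem : ∀ g ∈ pureAlg K 6, φ g ∈ N := by
      intro g hg
      obtain ⟨c, hc, rfl⟩ := hfin g hg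
      rw [map_sum]
      refine Submodule.sum_mem _ fun j _ => ?_
      rw [map_mul]
      exact N.smul_mem (⟨φ (c j), hsub _ (hc j)⟩ : A) (Submodule.subset_span ⟨j, rfl⟩)
    have h1 : (1 : MvPolynomial (Fin r) K) ∈ N := by
      have := hmem 1 (one_mem _)
      rwa [map_one] at this
    refine isIntegral_of_smul_mem_submodule N ?_ (Submodule.fg_span (Set.finite_range _)) _ ?_
    · intro h
      rw [h] at h1
      exact one_ne_zero ((Submodule.mem_bot _).mp h1)
    · intro n hn
      induction hn using Submodule.span_induction with
      | mem x hx =>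
        obtain ⟨j, rfl⟩ := hx
        have := hmem _ (mul_mem hf (hQ j))
        rwa [map_mul] at this
      | zero => rw [smul_zero]; exact N.zero_mem
      | add x y _ _ hx hy => rw [smul_add]; exact N.add_mem hx hy
      | smul c x _ hx => rw [smul_comm]; exact N.smul_mem c hx
  have hvar : ∀ k : Fin r, IsIntegral A (MvPolynomial.X k : MvPolynomial (Fin r) K) := by
    intro k
    obtain ⟨u, hu, hku⟩ := hl k
    have hroot : (wordEv l X Y).charpoly.eval (MvPolynomial.X k) = 0 := by
      rw [Matrix.eval_charpoly]
      refine Matrix.exists_mulVec_eq_zero_iff.mp ⟨u, hu, ?_⟩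
      rw [Matrix.sub_mulVec, hku]
      simp [Matrix.scalar_apply]
    have hco : ∀ n, IsIntegral A ((wordEv l X Y).charpoly.coeff n) := by
      intro n
      rw [← aeval_coeff (K := K)]
      exact hint _ (coeff_mem l n)
    exact integral_of_root _ (Matrix.charpoly_monic _) hco _ hroot
  have halg : Algebra.IsIntegral A (MvPolynomial (Fin r) K) := by
    constructor
    intro f
    induction f using MvPolynomial.induction_on with
    | C c => exact isIntegral_algebraMap (x := algebraMap K A c)
    | add f g hf hg => exact hf.add hg
    | mul_X f k hf => exact hf.mul (hvar k)
  have : Algebra.IsAlgebraic (Algebra.adjoin K T) (MvPolynomial (Fin r) K) := halg.isAlgebraic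
  have h1 := Algebra.IsAlgebraic.trdeg_le_cardinalMk K T
  rw [MvPolynomial.trdeg_of_isDomain] at h1
  have h2 : Cardinal.mk T ≤ (S.card : Cardinal) := by
    simpa using Cardinal.mk_image_le_lift (f := fun i => φ (P i)) (s := (S : Set (Fin 37)))
  have := h1.trans h2
  simpa using this

lemma wordEv_cons {R : Type*} [CommRing R] (t : Bool) (l : List Bool)
    (A B : Matrix (Fin 6) (Fin 6) R) :
    wordEv (t :: l) A B = (if t then A else B) * wordEv l A B := by
  simp [wordEv]

lemma wordEv_append {R : Type*} [CommRing R] (l l' : List Bool)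
    (A B : Matrix (Fin 6) (Fin 6) R) :
    wordEv (l ++ l') A B = wordEv l A B * wordEv l' A B := by
  simp [wordEv]

lemma shift_up {R : Type*} [CommRing R] (Y : Matrix (Fin 6) (Fin 6) R) (n j : ℕ) (h : j + n < 6)
    (c : R) :
    wordEv (List.replicate n true)
      (Matrix.of fun i j : Fin 6 => if (i : ℕ) = j + 1 then (1 : R) else 0) Y *ᵥ
        Pi.single ⟨j, by omega⟩ c = Pi.single ⟨j + n, h⟩ c := by
  induction n with
  | zero => simp only [wordEv, List.replicate_zero, List.map_nil, List.prod_nil, Matrix.one_mulVec, add_zero]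
  | succ n ih =>
    rw [List.replicate_succ, wordEv_cons, ← Matrix.mulVec_mulVec, ih (by omega)]
    ext i
    simp [Matrix.mulVec_single, Pi.single_apply, Fin.ext_iff, add_assoc]

lemma shift_down {R : Type*} [CommRing R] (X : Matrix (Fin 6) (Fin 6) R) (n j : ℕ) (h : j + n < 6)
    (c : R) :
    wordEv (List.replicate n false) X
      (Matrix.of fun i j : Fin 6 => if (i : ℕ) + 1 = j then (1 : R) else 0) *ᵥ
        Pi.single ⟨j + n, h⟩ c = Pi.single ⟨j, by omega⟩ c := by
  induction n generalizing j with
  | zero => simp only [wordEv, List.replicate_zero, List.map_nil, List.prod_nil, Matrix.one_mulVec, add_zero]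
  | succ n ih =>
    have := ih (j + 1) (by omega)
    simp only [show j + 1 + n = j + (n + 1) by omega] at this
    rw [List.replicate_succ, wordEv_cons, ← Matrix.mulVec_mulVec, this]
    ext i
    simp [Matrix.mulVec_single, Pi.single_apply, Fin.ext_iff]

/-- The `ℤ²`-graded algebra `C_{6,2}` has no bigraded system of parameters: there is no
family of 37 bihomogeneous invariants `P₁, …, P₃₇` (37 being the Krull dimension of
`C_{6,2}`) such that `C_{6,2}` is a finitely generated module over the subalgebra
`K[P₁, …, P₃₇]` they generate. -/
theorem no_bigraded_hsop_C62 (K : Type*) [Field K] [CharZero K] :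
    ¬ ∃ P : Fin 37 → MvPolynomial (MatVar 6) K,
        (∀ i, P i ∈ pureAlg K 6) ∧
        (∀ i, ∃ p q : ℕ, (P i).IsWeightedHomogeneous (bideg 6) (p, q)) ∧
        ∃ (m : ℕ) (Q : Fin m → MvPolynomial (MatVar 6) K),
          (∀ j, Q j ∈ pureAlg K 6) ∧
          ∀ f ∈ pureAlg K 6, ∃ c : Fin m → MvPolynomial (MatVar 6) K,
            (∀ j, c j ∈ Algebra.adjoin K (Set.range P)) ∧ f = ∑ j, c j * Q j := by
  
  rintro ⟨P, hP, hh, m, Q, hQ, hfin⟩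
  choose p q hh using hh
  let F : ℕ × ℕ → Finset (Fin 37) := fun d =>
    Finset.univ.filter fun i => d.1 * p i = d.2 * q i ∧ (p i ≠ 0 ∨ q i ≠ 0)
  have hA : ∀ b ≤ 5, 6 - b ≤ (F (1, b)).card := fun b hb =>
    key hP hh hfin hQ 1 b (6 - b)
      (Matrix.of fun i j => if (i : ℕ) = j + 1 then 1 else 0)
      (Matrix.of fun i j => if h : (i : ℕ) + b = j then MvPolynomial.X ⟨i, by omega⟩ else 0)
      (by intro i j h; simp at h; exact h)
      (by intro i j h; simp at h; exact h)
      (List.replicate b true ++ [false])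
      (by
        intro k
        refine ⟨Pi.single ⟨k + b, by omega⟩ 1, by simp, ?_⟩
        rw [wordEv_append, ← Matrix.mulVec_mulVec]
        have e : ∀ X Y : Matrix (Fin 6) (Fin 6) (MvPolynomial (Fin (6 - b)) K),
          wordEv [false] X Y = Y := by simp [wordEv]
        rw [e]
        have : (Matrix.of fun i j : Fin 6 => if h : (i : ℕ) + b = j then
            (MvPolynomial.X ⟨i, by omega⟩ : MvPolynomial (Fin (6 - b)) K) else 0) *ᵥ
            Pi.single ⟨k + b, by omega⟩ 1 =
            Pi.single ⟨k, by omega⟩ (MvPolynomial.X k : MvPolynomial (Fin (6 - b)) K) := by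
          ext1 i
          by_cases h : (i : ℕ) = k
          · simp [Matrix.mulVec_single, Pi.single_apply, Fin.ext_iff, h]
          · simp [Matrix.mulVec_single, Pi.single_apply, Fin.ext_iff, h]
        rw [this, shift_up _ b k (by omega)]
        ext1 i
        simp [Pi.single_apply])
  have hB : ∀ a ≤ 5, 6 - a ≤ (F (a, 1)).card := fun a ha =>
    key hP hh hfin hQ a 1 (6 - a)
      (Matrix.of fun i j => if h : (i : ℕ) = j + a then MvPolynomial.X ⟨j, by omega⟩ else 0)
      (Matrix.of fun i j => if (i : ℕ) + 1 = j then 1 else 0)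
      (by intro i j h; simp at h; exact h)
      (by intro i j h; simp at h; exact h)
      (List.replicate a false ++ [true])
      (by
        intro k
        refine ⟨Pi.single ⟨k, by omega⟩ 1, by simp, ?_⟩
        rw [wordEv_append, ← Matrix.mulVec_mulVec]
        have e : ∀ X Y : Matrix (Fin 6) (Fin 6) (MvPolynomial (Fin (6 - a)) K),
          wordEv [true] X Y = X := by simp [wordEv]
        rw [e]
        have : (Matrix.of fun i j : Fin 6 => if h : (i : ℕ) = j + a then
            (MvPolynomial.X ⟨j, by omega⟩ : MvPolynomial (Fin (6 - a)) K) else 0) *ᵥ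
            Pi.single ⟨k, by omega⟩ 1 =
            Pi.single ⟨k + a, by omega⟩ (MvPolynomial.X k : MvPolynomial (Fin (6 - a)) K) := by
          ext1 i
          by_cases h : (i : ℕ) = k + a
          · simp [Matrix.mulVec_single, Pi.single_apply, Fin.ext_iff, h]
          · simp [Matrix.mulVec_single, Pi.single_apply, Fin.ext_iff, h]
        rw [this, shift_down _ a k (by omega)]
        ext1 i
        simp [Pi.single_apply])
  have hC : 1 ≤ (F (2, 3)).card :=
    key hP hh hfin hQ 2 3 1
      !![0, 0, 0, 0, 0, 0; 0, 0, 0, 0, 0, 0; 1, 0, 0, 0, 0, 0; 0, 1, 0, 0, 0, 0; 0, 0, 1, 0, 0, 0;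
        0, 0, 0, 0, 0, 0]
      !![0, 0, 0, MvPolynomial.X 0, 0, 0; 0, 0, 0, 0, 1, 0; 0, 0, 0, 0, 0, 0; 0, 0, 0, 0, 0, 0;
        0, 0, 0, 0, 0, 0; 0, 0, 0, 0, 0, 0]
      (by intro i j h; fin_cases i <;> fin_cases j <;> simp_all)
      (by intro i j h; fin_cases i <;> fin_cases j <;> simp_all)
      [false, true, false, true, true]
      (by
        intro k
        refine ⟨Pi.single 0 1, by simp, ?_⟩
        have hk : k = 0 := Subsingleton.elim _ _
        subst hk
        simp only [wordEv_cons, ← Matrix.mulVec_mulVec, if_true, if_false, Bool.false_eq_true]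
        ext1 i
        fin_cases i <;> simp [wordEv, Matrix.mulVec, dotProduct, Fin.sum_univ_succ])
  let D : Finset (ℕ × ℕ) := {(1, 0), (1, 1), (1, 2), (1, 3), (1, 4), (1, 5),
    (0, 1), (2, 1), (3, 1), (4, 1), (5, 1), (2, 3)}
  have hDD : ∀ d ∈ D, ∀ e ∈ D, d ≠ e → d.1 * e.2 ≠ e.1 * d.2 := by decide
  have hdis : Set.PairwiseDisjoint (D : Set (ℕ × ℕ)) F := by
    intro d hd e he hde
    have hne := hDD d hd e he hde
    refine Finset.disjoint_left.mpr fun i h1 h2 => ?_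
    simp only [F, Finset.mem_filter, Finset.mem_univ, true_and] at h1 h2
    obtain ⟨h1, h3⟩ := h1
    obtain ⟨h2, -⟩ := h2
    have e1 : (d.1 * e.2) * p i = (e.1 * d.2) * p i := by
      calc _ = e.2 * (d.1 * p i) := by ring
        _ = d.2 * (e.2 * q i) := by rw [h1]; ring
        _ = _ := by rw [← h2]; ring
    have e2 : (d.1 * e.2) * q i = (e.1 * d.2) * q i := by
      calc _ = d.1 * (e.2 * q i) := by ring
        _ = e.1 * (d.1 * p i) := by rw [← h2]; ring
        _ = _ := by rw [h1]; ring
    rcases h3 with h3 | h3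
    · exact hne (Nat.eq_of_mul_eq_mul_right (Nat.pos_of_ne_zero h3) e1)
    · exact hne (Nat.eq_of_mul_eq_mul_right (Nat.pos_of_ne_zero h3) e2)
  have hcard := Finset.card_biUnion hdis
  have hle : (D.biUnion F).card ≤ 37 := by
    simpa using Finset.card_le_univ (D.biUnion F)
  have hsum : ∑ d ∈ D, (F d).card = (F (1, 0)).card + ((F (1, 1)).card + ((F (1, 2)).card +
      ((F (1, 3)).card + ((F (1, 4)).card + ((F (1, 5)).card + ((F (0, 1)).card +
      ((F (2, 1)).card + ((F (3, 1)).card + ((F (4, 1)).card + ((F (5, 1)).card +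
      (F (2, 3)).card)))))))))) := by
    simp only [D]
    repeat rw [Finset.sum_insert (by decide)]
    rw [Finset.sum_singleton]
  have a0 := hA 0 (by norm_num)
  have a1 := hA 1 (by norm_num)
  have a2 := hA 2 (by norm_num)
  have a3 := hA 3 (by norm_num)
  have a4 := hA 4 (by norm_num)
  have a5 := hA 5 (by norm_num)
  have b0 := hB 0 (by norm_num)
  have b2 := hB 2 (by norm_num)
  have b3 := hB 3 (by norm_num)
  have b4 := hB 4 (by norm_num)
  have b5 := hB 5 (by norm_num)
  omega
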